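/- Let A be a linear isometry of Euclidean ℝ⁷ that preserves the fundamental G₂-form ω³, i.e. ω³(AX, AY, AZ) = ω³(X, Y, Z) for all vectors X, Y, Z. If A fixes four linearly independent vectors v₁, v₂, v₃, v₄ of ℝ⁷ (A vᵢ = vᵢ for i = 1,2,3,4), then A is the identity map. (The subgroup of G₂ preserving four linearly independent vectors in ℝ⁷ is trivial.) -/

import Mathlib

noncomputable section

/-- Euclidean 7-space. -/
abbrev E7 : Type := EuclideanSpace ℝ (Fin 7)

/-- The standard orthonormal basis vectors `e₁, …, e₇` (0-indexed). -/
def e (i : Fin 7) : E7 := EuclideanSpace.single i 1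

/-- The alternating 3-form `eⁱ ∧ eʲ ∧ eᵏ` evaluated on three vectors. -/
def w3 (i j k : Fin 7) (X Y Z : E7) : ℝ :=
  X i * (Y j * Z k - Y k * Z j) - X j * (Y i * Z k - Y k * Z i)
    + X k * (Y i * Z j - Y j * Z i)

/-- The fundamental G₂-form
`ω³ = e₁₂₇ + e₁₃₅ − e₁₄₆ − e₂₃₆ − e₂₄₅ + e₃₄₇ + e₅₆₇`. -/
def ω3 (X Y Z : E7) : ℝ :=
  w3 0 1 6 X Y Z + w3 0 2 4 X Y Z - w3 0 3 5 X Y Z - w3 1 2 5 X Y Z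
    - w3 1 3 4 X Y Z + w3 2 3 6 X Y Z + w3 4 5 6 X Y Z

/-- The `G₂` cross product, characterised by `⟪g2Cross X Y, Z⟫ = ω³(X, Y, Z)`,
as a linear map in its second argument. -/
def g2Cross (X : E7) : E7 →ₗ[ℝ] E7 where
  toFun Y := WithLp.toLp 2 fun k => ω3 X Y (e k)
  map_add' Y Z := by
    ext k
    simp only [ω3, w3, PiLp.add_apply]
    ring
  map_smul' c Y := by
    ext k
    simp only [ω3, w3, PiLp.smul_apply, smul_eq_mul, RingHom.id_apply]
    ring

lemma g2Cross_apply (X Y : E7) (k : Fin 7) : g2Cross X Y k = ω3 X Y (e k) := rfl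

lemma inner_g2Cross (X Y Z : E7) : inner ℝ (g2Cross X Y) Z = ω3 X Y Z := by
  simp only [PiLp.inner_apply, Fin.sum_univ_seven]
  simp [g2Cross_apply, ω3, w3, e]
  ring

lemma ω3_rotate (X Y Z : E7) : ω3 X Y Z = ω3 Y Z X := by
  simp only [ω3, w3]
  ring

lemma inner_g2Cross_self (X Y : E7) :
    inner ℝ (g2Cross X Y) (g2Cross X Y) = inner ℝ X X * inner ℝ Y Y - inner ℝ X Y ^ 2 := by
  simp only [PiLp.inner_apply, Fin.sum_univ_seven]
  simp [g2Cross_apply, ω3, w3, e]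
  ring

/-- A vector moved by an isometry to one with the same inner product against it is fixed. -/
lemma LinearIsometry.apply_eq_self_of_inner {V : Type*} [NormedAddCommGroup V]
    [InnerProductSpace ℝ V] (A : V →ₗᵢ[ℝ] V) {p : V} (h : inner ℝ p (A p) = inner ℝ p p) :
    A p = p := by
  rw [← sub_eq_zero, ← inner_self_eq_zero (𝕜 := ℝ), inner_sub_left, inner_sub_right,
    inner_sub_right, A.inner_map_map, real_inner_comm p (A p), h]
  ring

/-- A subspace of dimension at least four closed under the cross product is everything. -/
lemma eq_top_of_g2Cross_mem (F : Submodule ℝ E7) (hF : ∀ X ∈ F, ∀ Y ∈ F, g2Cross X Y ∈ F)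
    (hdim : 4 ≤ Module.finrank ℝ F) : F = ⊤ := by
  rw [← Submodule.orthogonal_eq_bot_iff, Submodule.eq_bot_iff]
  intro n hn
  by_contra hn0
  have horth : ∀ X ∈ F, g2Cross n X ∈ Fᗮ := fun X hX => by
    rw [Submodule.mem_orthogonal']
    intro Y hY
    rw [inner_g2Cross, ω3_rotate, ← inner_g2Cross]
    exact hn _ (hF X hX Y hY)
  have hinj : Function.Injective ((g2Cross n).restrict horth) := by
    rw [injective_iff_map_eq_zero]
    intro X hX
    have h0 : g2Cross n X = 0 := congrArg Subtype.val hX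
    have hsq := inner_g2Cross_self n X
    rw [h0, (Submodule.mem_orthogonal' F n).1 hn X X.2, inner_zero_left] at hsq
    have hprod : inner ℝ n n * inner ℝ (X : E7) X = 0 := by linarith
    rcases mul_eq_zero.1 hprod with h | h
    · exact absurd (inner_self_eq_zero.1 h) hn0
    · exact Subtype.ext (inner_self_eq_zero.1 h)
  have hle := LinearMap.finrank_le_finrank_of_injective hinj
  have hsum := F.finrank_add_finrank_orthogonal
  rw [finrank_euclideanSpace_fin] at hsum
  omega

/-- a linear isometry of ℝ⁷ preserving the fundamental G₂-form
`ω³` which fixes four linearly independent vectors is the identity map. -/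
theorem stmt_11 (A : E7 →ₗᵢ[ℝ] E7)
    (hω : ∀ X Y Z : E7, ω3 (A X) (A Y) (A Z) = ω3 X Y Z)
    (v₁ v₂ v₃ v₄ : E7) (hind : LinearIndependent ℝ ![v₁, v₂, v₃, v₄])
    (h₁ : A v₁ = v₁) (h₂ : A v₂ = v₂) (h₃ : A v₃ = v₃) (h₄ : A v₄ = v₄) :
    ∀ X : E7, A X = X := by
  let F : Submodule ℝ E7 := LinearMap.eqLocus A.toLinearMap LinearMap.id
  have hcross : ∀ X ∈ F, ∀ Y ∈ F, g2Cross X Y ∈ F := fun X hX Y hY => by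
    have hX : A X = X := hX
    have hY : A Y = Y := hY
    refine A.apply_eq_self_of_inner ?_
    have h := hω X Y (g2Cross X Y)
    rwa [hX, hY, ← inner_g2Cross, ← inner_g2Cross] at h
  have hspan : Submodule.span ℝ (Set.range ![v₁, v₂, v₃, v₄]) ≤ F := by
    rw [Submodule.span_le]
    rintro _ ⟨i, rfl⟩
    fin_cases i
    exacts [h₁, h₂, h₃, h₄]
  have hdim : 4 ≤ Module.finrank ℝ F := by
    simpa [finrank_span_eq_card hind] using Submodule.finrank_mono hspan
  intro X
  have hX : X ∈ F := eq_top_of_g2Cross_mem F hcross hdim ▸ Submodule.mem_top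
  exact hX
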